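/- Let Φ be a Euclidean ring. An automorphism φ = (f₁, f₂) of Φ[x₁,x₂] satisfies D(φ) = (x₁, x₂, 2e), where e = |1|, if and only if either f₁ = α₁x₁ + β₁x₂ + γ₁ and f₂ = β₂x₂ + γ₂ with α₁, β₂ units of Φ and β₁, γ₁, γ₂ ∈ Φ, or f₁ = β₃x₂ + γ₃ and f₂ = α₂x₁ + β₄x₂ + γ₄ with α₂, β₃ units of Φ and β₄, γ₃, γ₄ ∈ Φ. -/

import Mathlib

open MvPolynomial

/-- The group of `Φ`-algebra automorphisms of `Φ[x₁,x₂]`. -/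
abbrev PolyAut (Φ : Type*) [CommRing Φ] :=
  MvPolynomial (Fin 2) Φ ≃ₐ[Φ] MvPolynomial (Fin 2) Φ

/-- `Φ` together with `ν` is a Euclidean ring: an integral domain, not a field, with a norm
`ν` on nonzero elements such that (E1) `ν a ≤ ν (a*b)` with equality iff `b` is a unit, and
(E2) division with remainder holds. -/
structure IsEuclideanNorm (Φ : Type*) [CommRing Φ] [IsDomain Φ] (ν : Φ → ℕ) : Prop where
  not_field : ¬ IsField Φ
  norm_le : ∀ a b : Φ, a ≠ 0 → b ≠ 0 → ν a ≤ ν (a * b)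
  norm_eq_iff_unit : ∀ a b : Φ, a ≠ 0 → b ≠ 0 → (ν (a * b) = ν a ↔ IsUnit b)
  division : ∀ a b : Φ, b ≠ 0 → ∃ q r : Φ, a = b * q + r ∧ (r = 0 ∨ ν r < ν b)

/-- The monomial `x₁^l x₂^m` is encoded by the pair `(l + m, l)`; the lexicographic order on
these pairs is exactly the order `u < v` iff `deg u < deg v`, or `deg u = deg v` and
`deg_{x₁} u < deg_{x₁} v`. -/
def mkey (d : Fin 2 →₀ ℕ) : ℕ ×ₗ ℕ := toLex (d 0 + d 1, d 0)

/-- The key of the leading monomial of `f`: the largest key of a monomial in the support. -/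
noncomputable def leadKey {Φ : Type*} [CommRing Φ] (f : MvPolynomial (Fin 2) Φ) : ℕ ×ₗ ℕ :=
  f.support.sup mkey

/-- The leading monomial `f̄` of `f` (as an exponent vector). -/
noncomputable def leadMon {Φ : Type*} [CommRing Φ] (f : MvPolynomial (Fin 2) Φ) :
    Fin 2 →₀ ℕ :=
  Finsupp.single 0 (ofLex (leadKey f)).2 +
    Finsupp.single 1 ((ofLex (leadKey f)).1 - (ofLex (leadKey f)).2)

/-- The leading coefficient `lc f` of `f`. -/
noncomputable def lc {Φ : Type*} [CommRing Φ] (f : MvPolynomial (Fin 2) Φ) : Φ :=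
  f.coeff (leadMon f)

/-- The leading term `f′ = lc(f)·f̄` of `f`. -/
noncomputable def leadTerm {Φ : Type*} [CommRing Φ] (f : MvPolynomial (Fin 2) Φ) :
    MvPolynomial (Fin 2) Φ :=
  monomial (leadMon f) (lc f)

/-- The value `D(φ) = (u, v, ν(lc f₁) + ν(lc f₂)) ∈ W² × ℕ` of an automorphism
`φ = (f₁, f₂)`, where `{u, v} = {f̄₁, f̄₂}`, `u ≥ v`, monomials being encoded by their keys,
and `W² × ℕ` carries the lexicographic order. -/
noncomputable def DAut {Φ : Type*} [CommRing Φ] (ν : Φ → ℕ) (φ : PolyAut Φ) :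
    Lex ((ℕ ×ₗ ℕ) × Lex ((ℕ ×ₗ ℕ) × ℕ)) :=
  toLex (max (leadKey (φ (X 0))) (leadKey (φ (X 1))),
    toLex (min (leadKey (φ (X 0))) (leadKey (φ (X 1))),
      ν (lc (φ (X 0))) + ν (lc (φ (X 1)))))

/-- The value `(x₁, x₂, 2e)` where `e = ν 1`. -/
def DId (e : ℕ) : Lex ((ℕ ×ₗ ℕ) × Lex ((ℕ ×ₗ ℕ) × ℕ)) :=
  toLex (toLex (1, 1), toLex (toLex (1, 0), 2 * e))

/-- `ψ` is obtained from `θ` by a single elementary transformation: one component `fᵢ` of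
`θ = (f₁, f₂)` is replaced by `αfᵢ + g` with `α` a unit and `g` in the `Φ`-subalgebra
generated by the other component. -/
def ElemStep {Φ : Type*} [CommRing Φ] (θ ψ : PolyAut Φ) : Prop :=
  (∃ (α : Φˣ) (g : MvPolynomial (Fin 2) Φ), g ∈ Algebra.adjoin Φ {θ (X 1)} ∧
      ψ (X 0) = C (α : Φ) * θ (X 0) + g ∧ ψ (X 1) = θ (X 1)) ∨
  (∃ (α : Φˣ) (g : MvPolynomial (Fin 2) Φ), g ∈ Algebra.adjoin Φ {θ (X 0)} ∧
      ψ (X 0) = θ (X 0) ∧ ψ (X 1) = C (α : Φ) * θ (X 1) + g)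

/-- `θ` admits an elementary `D`-reduction: some elementary transformation of `θ` yields an
automorphism `ψ` with `D(ψ) ≺ D(θ)`. -/
def ElemDReducible {Φ : Type*} [CommRing Φ] (ν : Φ → ℕ) (θ : PolyAut Φ) : Prop :=
  ∃ ψ : PolyAut Φ, ElemStep θ ψ ∧ DAut ν ψ < DAut ν θ

section LeadingTerms

variable {Φ : Type*} [CommRing Φ]

theorem mkey_injective : Function.Injective mkey := by
  intro d d' h
  have h' : (d 0 + d 1, d 0) = (d' 0 + d' 1, d' 0) := congrArg ofLex h
  rw [Prod.mk.injEq] at h'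
  ext i
  fin_cases i
  · exact h'.2
  · change d 1 = d' 1
    omega

theorem mkey_single_zero : mkey (Finsupp.single 0 1) = toLex (1, 1) := by
  simp [mkey]

theorem mkey_single_one : mkey (Finsupp.single 1 1) = toLex (1, 0) := by
  simp [mkey]

theorem mkey_zero : mkey 0 = toLex (0, 0) := by
  simp [mkey]

theorem mkey_le_leadKey {f : MvPolynomial (Fin 2) Φ} {d : Fin 2 →₀ ℕ} (h : f.coeff d ≠ 0) :
    mkey d ≤ leadKey f :=
  Finset.le_sup (f := mkey) (mem_support_iff.2 h)

theorem exists_mkey_eq_leadKey {f : MvPolynomial (Fin 2) Φ} (h : leadKey f ≠ toLex (0, 0)) :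
    ∃ d, f.coeff d ≠ 0 ∧ mkey d = leadKey f := by
  have hne : f.support.Nonempty := by
    rw [Finset.nonempty_iff_ne_empty]
    intro h0
    apply h
    rw [leadKey, h0, Finset.sup_empty]
    rfl
  obtain ⟨d, hd, he⟩ := Finset.exists_mem_eq_sup f.support hne mkey
  exact ⟨d, mem_support_iff.1 hd, he.symm⟩

theorem eq_of_mkey_le {d : Fin 2 →₀ ℕ} (h : mkey d ≤ toLex (1, 1)) :
    d = Finsupp.single 0 1 ∨ d = Finsupp.single 1 1 ∨ d = 0 := by
  have h' : d 0 + d 1 < 1 ∨ d 0 + d 1 = 1 ∧ d 0 ≤ 1 := Prod.Lex.toLex_le_toLex.1 h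
  have key : mkey d = toLex (1, 1) ∨ mkey d = toLex (1, 0) ∨ mkey d = toLex (0, 0) := by
    simp only [mkey, toLex_inj, Prod.mk.injEq]
    omega
  rw [← mkey_single_zero, ← mkey_single_one, ← mkey_zero] at key
  exact key.imp (@mkey_injective _ _) (Or.imp (@mkey_injective _ _) (@mkey_injective _ _))

theorem zero_ne_single_one (i : Fin 2) : (0 : Fin 2 →₀ ℕ) ≠ Finsupp.single i 1 := by
  simp [eq_comm]

theorem coeff_affine (a b c : Φ) (d : Fin 2 →₀ ℕ) :
    coeff d (C a * X 0 + C b * X 1 + C c : MvPolynomial (Fin 2) Φ) =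
      (if Finsupp.single 0 1 = d then a else 0) + (if Finsupp.single 1 1 = d then b else 0) +
        (if 0 = d then c else 0) := by
  classical
  simp [coeff_C_mul, coeff_X, coeff_C]

theorem eq_of_coeff_affine_ne_zero {a b c : Φ} {d : Fin 2 →₀ ℕ}
    (h : coeff d (C a * X 0 + C b * X 1 + C c : MvPolynomial (Fin 2) Φ) ≠ 0) :
    (d = Finsupp.single 0 1 ∧ a ≠ 0) ∨ d = Finsupp.single 1 1 ∨ d = 0 := by
  contrapose! h
  obtain ⟨h₀, h₁, h₂⟩ := h
  rw [coeff_affine, if_neg h₁.symm, if_neg h₂.symm, add_zero, add_zero]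
  split_ifs with hd
  · exact h₀ hd.symm
  · rfl

theorem eq_affine_of_leadKey_le {f : MvPolynomial (Fin 2) Φ} (h : leadKey f ≤ toLex (1, 1)) :
    f = C (f.coeff (Finsupp.single 0 1)) * X 0 + C (f.coeff (Finsupp.single 1 1)) * X 1 +
      C (f.coeff 0) := by
  have h01 : (Finsupp.single 0 1 : Fin 2 →₀ ℕ) ≠ Finsupp.single 1 1 := by
    simp [Finsupp.single_eq_single_iff]
  ext d
  rw [coeff_affine]
  by_cases hd : f.coeff d = 0
  · rw [hd]
    split_ifs <;> simp_all
  · obtain rfl | rfl | rfl := eq_of_mkey_le ((mkey_le_leadKey hd).trans h) <;>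
      simp [h01, h01.symm, zero_ne_single_one]

theorem leadKey_affine_le (a b c : Φ) :
    leadKey (C a * X 0 + C b * X 1 + C c : MvPolynomial (Fin 2) Φ) ≤ toLex (1, 1) := by
  refine Finset.sup_le fun d hd => ?_
  obtain ⟨rfl, -⟩ | rfl | rfl := eq_of_coeff_affine_ne_zero (mem_support_iff.1 hd) <;>
    simp [mkey, Prod.Lex.toLex_le_toLex]

theorem leadKey_eq_one_one_iff {f : MvPolynomial (Fin 2) Φ} :
    leadKey f = toLex (1, 1) ↔
      ∃ a b c : Φ, a ≠ 0 ∧ f = C a * X 0 + C b * X 1 + C c := by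
  constructor
  · intro h
    obtain ⟨d, hd, he⟩ := exists_mkey_eq_leadKey (f := f) (by rw [h]; simp)
    rw [h, ← mkey_single_zero] at he
    rw [mkey_injective he] at hd
    exact ⟨_, _, _, hd, eq_affine_of_leadKey_le h.le⟩
  · rintro ⟨a, b, c, ha, rfl⟩
    refine le_antisymm (leadKey_affine_le a b c) ?_
    rw [← mkey_single_zero]
    apply mkey_le_leadKey
    rw [coeff_affine]
    simpa [Finsupp.single_eq_single_iff, zero_ne_single_one] using ha

theorem leadKey_eq_one_zero_iff {f : MvPolynomial (Fin 2) Φ} :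
    leadKey f = toLex (1, 0) ↔ ∃ b c : Φ, b ≠ 0 ∧ f = C b * X 1 + C c := by
  constructor
  · intro h
    have hlt : (toLex (1, 0) : ℕ ×ₗ ℕ) < toLex (1, 1) := by simp [Prod.Lex.toLex_lt_toLex]
    obtain ⟨d, hd, he⟩ := exists_mkey_eq_leadKey (f := f) (by rw [h]; simp)
    rw [h, ← mkey_single_one] at he
    rw [mkey_injective he] at hd
    have h0 : f.coeff (Finsupp.single 0 1) = 0 := by
      by_contra h0
      have := mkey_le_leadKey h0
      rw [h, mkey_single_zero] at this
      exact absurd this hlt.not_ge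
    have hf := eq_affine_of_leadKey_le (h.trans_le hlt.le)
    rw [h0, C_0, zero_mul, zero_add] at hf
    exact ⟨_, _, hd, hf⟩
  · rintro ⟨b, c, hb, rfl⟩
    have hf : (C b * X 1 + C c : MvPolynomial (Fin 2) Φ) = C 0 * X 0 + C b * X 1 + C c := by
      simp
    apply le_antisymm
    · refine Finset.sup_le fun d hd => ?_
      rw [mem_support_iff, hf] at hd
      obtain ⟨-, h0⟩ | rfl | rfl := eq_of_coeff_affine_ne_zero hd
      · exact absurd rfl h0
      · exact mkey_single_one.le
      · simp [mkey, Prod.Lex.toLex_le_toLex]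
    · rw [← mkey_single_one]
      apply mkey_le_leadKey
      rw [hf, coeff_affine]
      simpa [Finsupp.single_eq_single_iff, zero_ne_single_one] using hb

theorem lc_affine {a : Φ} (ha : a ≠ 0) (b c : Φ) :
    lc (C a * X 0 + C b * X 1 + C c : MvPolynomial (Fin 2) Φ) = a := by
  rw [lc, leadMon, leadKey_eq_one_one_iff.2 ⟨a, b, c, ha, rfl⟩, coeff_affine]
  simp [Finsupp.single_eq_single_iff, zero_ne_single_one]

theorem lc_affine_X_one {b : Φ} (hb : b ≠ 0) (c : Φ) :
    lc (C b * X 1 + C c : MvPolynomial (Fin 2) Φ) = b := by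
  have hf : (C b * X 1 + C c : MvPolynomial (Fin 2) Φ) = C 0 * X 0 + C b * X 1 + C c := by
    simp
  rw [lc, leadMon, leadKey_eq_one_zero_iff.2 ⟨b, c, hb, rfl⟩, hf, coeff_affine]
  simp [Finsupp.single_eq_single_iff, zero_ne_single_one]

theorem max_eq_and_min_eq_iff {α : Type*} [LinearOrder α] {x y p q : α} (h : q ≤ p) :
    max x y = p ∧ min x y = q ↔ (x = p ∧ y = q) ∨ (x = q ∧ y = p) := by
  constructor
  · rintro ⟨rfl, rfl⟩
    rcases le_total x y with h' | h' <;> simp [h']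
  · rintro (⟨rfl, rfl⟩ | ⟨rfl, rfl⟩) <;> simp [h]

theorem DAut_eq_iff (ν : Φ → ℕ) (φ : PolyAut Φ) (e : ℕ) :
    DAut ν φ = DId e ↔
      ((leadKey (φ (X 0)) = toLex (1, 1) ∧ leadKey (φ (X 1)) = toLex (1, 0)) ∨
        (leadKey (φ (X 0)) = toLex (1, 0) ∧ leadKey (φ (X 1)) = toLex (1, 1))) ∧
      ν (lc (φ (X 0))) + ν (lc (φ (X 1))) = 2 * e := by
  have h : (toLex (1, 0) : ℕ ×ₗ ℕ) ≤ toLex (1, 1) := by simp [Prod.Lex.toLex_le_toLex]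
  rw [← max_eq_and_min_eq_iff h, DAut, DId, toLex_inj, Prod.mk.injEq, toLex_inj, Prod.mk.injEq,
    and_assoc]

end LeadingTerms

namespace IsEuclideanNorm

variable {Φ : Type*} [CommRing Φ] [IsDomain Φ] {ν : Φ → ℕ}

theorem eq_one_iff_isUnit (hν : IsEuclideanNorm Φ ν) {a : Φ} (ha : a ≠ 0) :
    ν a = ν 1 ↔ IsUnit a := by
  simpa using hν.norm_eq_iff_unit 1 a one_ne_zero ha

theorem add_eq_two_mul_one_iff (hν : IsEuclideanNorm Φ ν) {a b : Φ} (ha : a ≠ 0) (hb : b ≠ 0) :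
    ν a + ν b = 2 * ν 1 ↔ IsUnit a ∧ IsUnit b := by
  have ha' : ν 1 ≤ ν a := by simpa using hν.norm_le 1 a one_ne_zero ha
  have hb' : ν 1 ≤ ν b := by simpa using hν.norm_le 1 b one_ne_zero hb
  rw [← hν.eq_one_iff_isUnit ha, ← hν.eq_one_iff_isUnit hb]
  omega

end IsEuclideanNorm

/-- Over a Euclidean ring `Φ`, an automorphism `φ = (f₁, f₂)` of `Φ[x₁,x₂]` satisfies
`D(φ) = (x₁, x₂, 2e)` (where `e = ν 1`) if and only if
`f₁ = α₁x₁ + β₁x₂ + γ₁`, `f₂ = β₂x₂ + γ₂` with `α₁, β₂` units, or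
`f₁ = β₃x₂ + γ₃`, `f₂ = α₂x₁ + β₄x₂ + γ₄` with `α₂, β₃` units. -/
theorem DAut_eq_DId_iff
    (Φ : Type*) [CommRing Φ] [IsDomain Φ] (ν : Φ → ℕ) (hν : IsEuclideanNorm Φ ν)
    (φ : PolyAut Φ) :
    DAut ν φ = DId (ν 1) ↔
      ((∃ (α₁ β₂ : Φˣ) (β₁ γ₁ γ₂ : Φ),
          φ (X 0) = C (α₁ : Φ) * X 0 + C β₁ * X 1 + C γ₁ ∧
          φ (X 1) = C (β₂ : Φ) * X 1 + C γ₂) ∨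
        (∃ (α₂ β₃ : Φˣ) (β₄ γ₃ γ₄ : Φ),
          φ (X 0) = C (β₃ : Φ) * X 1 + C γ₃ ∧
          φ (X 1) = C (α₂ : Φ) * X 0 + C β₄ * X 1 + C γ₄)) := by
  rw [DAut_eq_iff]
  constructor
  · rintro ⟨⟨h₀, h₁⟩ | ⟨h₀, h₁⟩, hsum⟩
    · obtain ⟨a, b, c, ha, hf₀⟩ := leadKey_eq_one_one_iff.1 h₀
      obtain ⟨b', c', hb', hf₁⟩ := leadKey_eq_one_zero_iff.1 h₁
      rw [hf₀, hf₁, lc_affine ha, lc_affine_X_one hb', hν.add_eq_two_mul_one_iff ha hb'] at hsum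
      obtain ⟨⟨u, rfl⟩, ⟨v, rfl⟩⟩ := hsum
      exact Or.inl ⟨u, v, b, c, c', hf₀, hf₁⟩
    · obtain ⟨b', c', hb', hf₀⟩ := leadKey_eq_one_zero_iff.1 h₀
      obtain ⟨a, b, c, ha, hf₁⟩ := leadKey_eq_one_one_iff.1 h₁
      rw [hf₀, hf₁, lc_affine ha, lc_affine_X_one hb', hν.add_eq_two_mul_one_iff hb' ha] at hsum
      obtain ⟨⟨v, rfl⟩, ⟨u, rfl⟩⟩ := hsum
      exact Or.inr ⟨u, v, b, c', c, hf₀, hf₁⟩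
  · rintro (⟨u, v, b, c, c', hf₀, hf₁⟩ | ⟨u, v, b, c', c, hf₀, hf₁⟩)
    · refine ⟨Or.inl ⟨leadKey_eq_one_one_iff.2 ⟨u, b, c, u.ne_zero, hf₀⟩,
        leadKey_eq_one_zero_iff.2 ⟨v, c', v.ne_zero, hf₁⟩⟩, ?_⟩
      rw [hf₀, hf₁, lc_affine u.ne_zero, lc_affine_X_one v.ne_zero,
        hν.add_eq_two_mul_one_iff u.ne_zero v.ne_zero]
      exact ⟨u.isUnit, v.isUnit⟩
    · refine ⟨Or.inr ⟨leadKey_eq_one_zero_iff.2 ⟨v, c', v.ne_zero, hf₀⟩,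
        leadKey_eq_one_one_iff.2 ⟨u, b, c, u.ne_zero, hf₁⟩⟩, ?_⟩
      rw [hf₀, hf₁, lc_affine u.ne_zero, lc_affine_X_one v.ne_zero,
        hν.add_eq_two_mul_one_iff v.ne_zero u.ne_zero]
      exact ⟨v.isUnit, u.isUnit⟩
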